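/- Let K be a formally real number field with real embeddings σ_1,…,σ_r : K → ℝ, let I ⊆ {1,…,r} be a subset, and let S be a finite set of finite places of K. Then there exists ρ ∈ K^× such that σ_i(ρ) < 0 for every i ∈ I, σ_j(ρ) > 0 for every j ∉ I, and ρ is a square in the completion K_𝔭 for every 𝔭 ∈ S. -/

import Mathlib

open NumberField IsDedekindDomain IsDedekindDomain.HeightOneSpectrum

theorem exists_sq_add_self_eq {F : Type*} [NormedField F] [CompleteSpace F] [IsUltrametricDist F]
    {c : F} (hc : ‖c‖ < 1) : ∃ y : F, y ^ 2 + y = c := by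
  have maps : Set.MapsTo (fun y : F ↦ c - y ^ 2) {y | ‖y‖ ≤ ‖c‖} {y | ‖y‖ ≤ ‖c‖} := by
    intro y (hy : ‖y‖ ≤ ‖c‖)
    have h1 : ‖y ^ 2‖ ≤ ‖c‖ := by
      rw [norm_pow]
      nlinarith [norm_nonneg y]
    change ‖c - y ^ 2‖ ≤ ‖c‖
    rw [sub_eq_add_neg]
    exact (IsUltrametricDist.norm_add_le_max _ _).trans (by simpa using h1)
  have complete : IsComplete {y : F | ‖y‖ ≤ ‖c‖} :=
    (isClosed_le continuous_norm continuous_const).isComplete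
  have contr : ContractingWith ‖c‖₊ (maps.restrict _ _ _) := by
    refine ⟨by exact_mod_cast hc, LipschitzWith.of_dist_le_mul ?_⟩
    rintro ⟨x, hx : ‖x‖ ≤ ‖c‖⟩ ⟨y, hy : ‖y‖ ≤ ‖c‖⟩
    change dist (c - x ^ 2) (c - y ^ 2) ≤ ‖c‖ * dist x y
    rw [dist_eq_norm, dist_eq_norm,
      show c - x ^ 2 - (c - y ^ 2) = -((x + y) * (x - y)) by ring, norm_neg, norm_mul]
    gcongr
    exact (IsUltrametricDist.norm_add_le_max _ _).trans (max_le hx hy)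
  obtain ⟨y, -, hy, -⟩ := contr.exists_fixedPoint' complete maps (x := 0) (by simp)
    (edist_ne_top _ _)
  have hy' : c - y ^ 2 = y := hy
  exact ⟨y, by linear_combination -hy'⟩

theorem isSquare_one_add_four_mul {F : Type*} [NormedField F] [CompleteSpace F]
    [IsUltrametricDist F] {c : F} (hc : ‖c‖ < 1) : IsSquare (1 + 4 * c) := by
  obtain ⟨y, rfl⟩ := exists_sq_add_self_eq hc
  exact ⟨1 + 2 * y, by ring⟩

theorem NumberField.InfinitePlace.mk_ofRealHom_comp_injective {K : Type*} [Field K] :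
    Function.Injective fun φ : K →+* ℝ ↦ InfinitePlace.mk (Complex.ofRealHom.comp φ) := by
  intro φ ψ h
  ext x
  rcases InfinitePlace.mk_eq_iff.mp h with h | h
  · simpa using RingHom.congr_fun h x
  · simpa [ComplexEmbedding.conjugate_coe_eq] using RingHom.congr_fun h x

theorem NumberField.exists_forall_real_embedding_neg_iff {K : Type*} [Field K] [NumberField K]
    (I : Set (K →+* ℝ)) :
    ∃ x : K, (∀ φ ∈ I, φ x < 0) ∧ ∀ φ ∉ I, 0 < φ x := by
  classical
  let place : (K →+* ℝ) → InfinitePlace K := fun φ ↦ .mk (Complex.ofRealHom.comp φ)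
  let s : InfinitePlace K → K := fun w ↦ if w ∈ place '' I then -1 else 1
  obtain ⟨x, hx⟩ := (InfinitePlace.denseRange_algebraMap_pi K).exists_dist_lt
    (fun w ↦ WithAbs.toAbs w.1 (s w)) one_pos
  have close (φ : K →+* ℝ) : |φ (s (place φ)) - φ x| < 1 := by
    have h := (dist_pi_lt_iff one_pos).mp hx (place φ)
    rw [dist_eq_norm, WithAbs.norm_eq_apply_ofAbs] at h
    have h' : place φ (s (place φ) - x) < 1 := h
    rw [InfinitePlace.apply] at h'
    simpa [← Complex.ofReal_sub, -map_sub, map_sub φ, Complex.norm_real] using h'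
  have mem (φ : K →+* ℝ) : place φ ∈ place '' I ↔ φ ∈ I :=
    InfinitePlace.mk_ofRealHom_comp_injective.mem_set_image
  refine ⟨x, fun φ hφ ↦ ?_, fun φ hφ ↦ ?_⟩
  · have h := close φ
    simp only [s, if_pos ((mem φ).mpr hφ), map_neg, map_one, abs_lt] at h
    linarith
  · have h := close φ
    simp only [s, if_neg (mt (mem φ).mp hφ), map_one, abs_lt] at h
    linarith

theorem NumberField.exists_integer_forall_real_embedding_neg_iff {K : Type*} [Field K]
    [NumberField K] (hreal : Nonempty (K →+* ℝ)) (I : Set (K →+* ℝ)) :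
    ∃ x : 𝓞 K, (∀ φ ∈ I, φ x < -1) ∧ ∀ φ ∉ I, 1 < φ x := by
  obtain ⟨x, hneg, hpos⟩ := exists_forall_real_embedding_neg_iff I
  have hx : x ≠ 0 := by
    rintro rfl
    obtain ⟨φ⟩ := hreal
    by_cases hφ : φ ∈ I
    · simpa using hneg φ hφ
    · simpa using hpos φ hφ
  obtain ⟨a, b, hb, rfl⟩ := IsFractionRing.div_surjective (A := 𝓞 K) x
  have hb0 : (b : K) ≠ 0 := by simpa using nonZeroDivisors.ne_zero hb
  have hab : (a : K) * b ≠ 0 := mul_ne_zero (fun h ↦ hx (by simp [h])) hb0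
  obtain ⟨n, hn⟩ : ∃ n : ℕ, ∀ w : InfinitePlace K, 1 < n * w (a * b) := by
    refine (Filter.eventually_all (l := Filter.atTop).mpr fun w ↦ ?_).exists
    exact (tendsto_natCast_atTop_atTop.atTop_mul_const
      (InfinitePlace.pos_iff.mpr hab)).eventually_gt_atTop 1
  have large (φ : K →+* ℝ) : 1 < n * |φ a * φ b| := by
    simpa [InfinitePlace.apply, abs_mul] using hn (.mk (Complex.ofRealHom.comp φ))
  have prod (φ : K →+* ℝ) : φ a * φ b = φ (a / b) * φ b ^ 2 := by
    have := (map_ne_zero φ).mpr hb0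
    rw [map_div₀]
    field_simp
  have sq_pos (φ : K →+* ℝ) : 0 < φ b ^ 2 := by
    have := (map_ne_zero φ).mpr hb0
    positivity
  refine ⟨n * (a * b), fun φ hφ ↦ ?_, fun φ hφ ↦ ?_⟩
  · have h := large φ
    rw [abs_of_neg (prod φ ▸ mul_neg_of_neg_of_pos (hneg φ hφ) (sq_pos φ))] at h
    simp only [map_mul, map_natCast]
    linarith
  · have h := large φ
    rw [abs_of_pos (prod φ ▸ mul_pos (hpos φ hφ) (sq_pos φ))] at h
    simpa using h

/-- Let `K` be a formally real number field (it admits a real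
embedding), `I` a set of real embeddings of `K`, and `S` a finite set of finite
places of `K`. Then there exists `ρ ∈ K^×` which is negative under every embedding
in `I`, positive under every real embedding not in `I`, and a square in the
completion `K_𝔭` for every `𝔭 ∈ S`. -/
theorem stmt5 {K : Type*} [Field K] [NumberField K] (hreal : Nonempty (K →+* ℝ))
    (I : Set (K →+* ℝ)) (S : Finset (HeightOneSpectrum (𝓞 K))) :
    ∃ ρ : K, ρ ≠ 0 ∧ (∀ φ : K →+* ℝ, φ ∈ I → φ ρ < 0) ∧
      (∀ φ : K →+* ℝ, φ ∉ I → 0 < φ ρ) ∧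
      ∀ v ∈ S, IsSquare (algebraMap K (v.adicCompletion K) ρ) := by
  obtain ⟨x, hneg, hpos⟩ := exists_integer_forall_real_embedding_neg_iff hreal I
  let q : ℕ := ∏ v ∈ S, Ideal.absNorm v.asIdeal
  have hq : (1 : ℝ) ≤ q := by
    exact_mod_cast Finset.prod_pos fun v _ ↦
      zero_lt_one.trans (NumberField.HeightOneSpectrum.one_lt_absNorm v)
  let ρ : K := 1 + 4 * (q * x : 𝓞 K)
  have hρ (φ : K →+* ℝ) : φ ρ = 1 + 4 * (q * φ x) := by simp [ρ, map_ofNat φ 4]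
  have neg (φ : K →+* ℝ) (hφ : φ ∈ I) : φ ρ < 0 := by
    rw [hρ]
    nlinarith [hneg φ hφ]
  have pos (φ : K →+* ℝ) (hφ : φ ∉ I) : 0 < φ ρ := by
    rw [hρ]
    nlinarith [hpos φ hφ]
  refine ⟨ρ, fun h ↦ ?_, neg, pos, fun v hv ↦ ?_⟩
  · obtain ⟨φ⟩ := hreal
    by_cases hφ : φ ∈ I
    · simpa [h] using neg φ hφ
    · simpa [h] using pos φ hφ
  · have hmem : (q * x : 𝓞 K) ∈ v.asIdeal :=
      Ideal.mul_mem_right _ _ <| Ideal.mem_of_dvd _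
        (Nat.cast_dvd_cast (Finset.dvd_prod_of_mem _ hv)) (Ideal.absNorm_mem _)
    have hnorm := (FinitePlace.norm_lt_one_iff_mem K v _).mpr hmem
    have := isSquare_one_add_four_mul hnorm
    have key : algebraMap K (v.adicCompletion K) ρ =
        1 + 4 * FinitePlace.embedding v (algebraMap (𝓞 K) K (q * x)) := by
      change FinitePlace.embedding v ρ = _
      simp [ρ, map_ofNat (FinitePlace.embedding v) 4]
    rwa [key]
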